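/- arXiv:2501.12771 — 2 statements merged into one kernel-verified Lean document; each statement's English description precedes it below -/
import Mathlib

section
/- Let k ≥ 1, let B be a finite set, and let H be a set of k-element subsets of B with |H| ≥ 2. Let S be a Bernoulli(e^{−1/k}) random subset of B (each element of B included independently with probability e^{−1/k}). Then the probability that S contains some member of H as a subset is at least 2/e − e^{−(k+1)/k}. -/
open MeasureTheory

/-- The Bernoulli(r) measure on `Bool`: `true` with probability `r`,
`false` with probability `1 - r`. -/
noncomputable def bernoulliMeasure (r : ℝ) : Measure Bool :=
  r.toNNReal • Measure.dirac true + (1 - r).toNNReal • Measure.dirac false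

instance (r : ℝ) : IsFiniteMeasure (bernoulliMeasure r) := by
  unfold bernoulliMeasure; infer_instance

/-- The distribution of a Bernoulli(r) random subset of `V`, encoded as the
product measure on `V → Bool` (a vertex `v` belongs to the subset iff the
coordinate at `v` is `true`). -/
noncomputable def bernoulliProduct (V : Type*) [Fintype V] (r : ℝ) :
    Measure (V → Bool) :=
  Measure.pi fun _ => bernoulliMeasure r

theorem bernoulliMeasure_singleton_true (r : ℝ) :
    bernoulliMeasure r {true} = ENNReal.ofReal r := by
  simp [bernoulliMeasure, ENNReal.ofReal]

theorem bernoulliMeasure_univ {r : ℝ} (h0 : 0 ≤ r) (h1 : r ≤ 1) :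
    bernoulliMeasure r Set.univ = 1 := by
  have h : ENNReal.ofReal r + ENNReal.ofReal (1 - r) = 1 := by
    rw [← ENNReal.ofReal_add h0 (by linarith)]
    simp
  simpa [bernoulliMeasure, ENNReal.ofReal] using h

theorem bernoulliProduct_forall_mem {V : Type*} [Fintype V] {r : ℝ} (h0 : 0 ≤ r) (h1 : r ≤ 1)
    (s : Finset V) :
    bernoulliProduct V r {f | ∀ v ∈ s, f v = true} = ENNReal.ofReal (r ^ s.card) := by
  classical
  have hset : {f : V → Bool | ∀ v ∈ s, f v = true} =
      Set.univ.pi fun v => if v ∈ s then {true} else Set.univ := by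
    ext f
    simp only [Set.mem_ofPred_eq, Set.mem_univ_pi]
    refine forall_congr' fun v => ?_
    by_cases hv : v ∈ s <;> simp [hv]
  have hfac (v : V) : bernoulliMeasure r (if v ∈ s then {true} else Set.univ) =
      if v ∈ s then ENNReal.ofReal r else 1 := by
    split_ifs
    · exact bernoulliMeasure_singleton_true r
    · exact bernoulliMeasure_univ h0 h1
  rw [hset, bernoulliProduct, Measure.pi_pi, Finset.prod_congr rfl fun v _ => hfac v,
    Finset.prod_ite_mem, Finset.univ_inter, Finset.prod_const, ENNReal.ofReal_pow h0]

theorem Finset.card_lt_card_union_of_card_eq_of_ne {α : Type*} [DecidableEq α] {s t : Finset α}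
    (hcard : s.card = t.card) (hne : s ≠ t) : s.card < (s ∪ t).card := by
  refine Finset.card_lt_card (Finset.ssubset_iff_subset_ne.2 ⟨Finset.subset_union_left, ?_⟩)
  intro h
  exact hne (Finset.eq_of_subset_of_card_le (Finset.left_eq_union.1 h) hcard.le).symm

theorem stmt3 {B : Type*} [Fintype B] (k : ℕ) (hk : 1 ≤ k)
    (H : Finset (Finset B)) (hunif : ∀ h ∈ H, h.card = k) (hH : 2 ≤ H.card) :
    ENNReal.ofReal (2 / Real.exp 1 - Real.exp (-((k + 1 : ℝ) / k))) ≤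
      bernoulliProduct B (Real.exp (-(1 / (k : ℝ))))
        {f | ∃ h ∈ H, ∀ v ∈ h, f v = true} := by
  classical
  obtain ⟨s, hs, t, ht, hst⟩ := Finset.one_lt_card.1 hH
  set r := Real.exp (-(1 / (k : ℝ))) with hr
  have hk0 : (k : ℝ) ≠ 0 := by positivity
  have h0 : 0 ≤ r := (Real.exp_pos _).le
  have h1 : r ≤ 1 := Real.exp_le_one_iff.2 (neg_nonpos.2 (by positivity))
  have hrk : r ^ k = 1 / Real.exp 1 := by
    rw [hr, ← Real.exp_nat_mul, one_div (Real.exp 1), ← Real.exp_neg]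
    congr 1
    field_simp
  have hrk1 : r ^ (k + 1) = Real.exp (-((k + 1 : ℝ) / k)) := by
    rw [hr, ← Real.exp_nat_mul]
    congr 1
    push_cast
    ring
  let E (u : Finset B) : Set (B → Bool) := {f | ∀ v ∈ u, f v = true}
  have hE (u : Finset B) : bernoulliProduct B r (E u) = ENNReal.ofReal (r ^ u.card) :=
    bernoulliProduct_forall_mem h0 h1 u
  have hinter : E s ∩ E t = E (s ∪ t) := by
    ext f
    simp [E, or_imp, forall_and]
  have hcard : k + 1 ≤ (s ∪ t).card := by
    have := Finset.card_lt_card_union_of_card_eq_of_ne ((hunif s hs).trans (hunif t ht).symm) hst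
    rwa [hunif s hs] at this
  rw [ENNReal.ofReal_sub _ (Real.exp_pos _).le, tsub_le_iff_right, ← hrk1]
  calc ENNReal.ofReal (2 / Real.exp 1)
      = bernoulliProduct B r (E s) + bernoulliProduct B r (E t) := by
        rw [hE, hE, hunif s hs, hunif t ht, ← ENNReal.ofReal_add (by positivity) (by positivity),
          hrk]
        congr 1
        ring
    _ = bernoulliProduct B r (E s ∪ E t) + bernoulliProduct B r (E s ∩ E t) :=
        (measure_union_add_inter _ (Set.toFinite _).measurableSet).symm
    _ ≤ _ := by
        gcongr
        · rintro f (hf | hf)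
          exacts [⟨s, hs, hf⟩, ⟨t, ht, hf⟩]
        · rw [hinter, hE]
          exact ENNReal.ofReal_le_ofReal (pow_le_pow_of_le_one h0 h1 hcard)
end

section
/- Let k ≥ 1, M = (1/e)·(1 − e^{−1/k}), and δ ∈ (0,1). Let V be a finite set, E a set of k-element subsets of V, and B ⊆ V a set containing at least two distinct hyperedges of E (at least two h ∈ E satisfy h ⊆ B). Let S_1, …, S_t be independent Bernoulli(e^{−1/k}) random subsets of B with t ≥ 2·ln(2/δ)/M², and let p̂ = (1/t)·|{i : some hyperedge of E is contained in S_i}|. Then Pr[p̂ ≥ 1/e + M/2] ≥ 1 − δ. -/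
open MeasureTheory

theorem isProbabilityMeasure_bernoulliMeasure {r : ℝ} (h0 : 0 ≤ r) (h1 : r ≤ 1) :
    IsProbabilityMeasure (bernoulliMeasure r) := by
  refine ⟨?_⟩
  have h : r.toNNReal + (1 - r).toNNReal = 1 := by
    rw [← Real.toNNReal_add h0 (by linarith)]
    simp
  simp only [bernoulliMeasure, Measure.coe_add, Pi.add_apply, Measure.smul_apply, measure_univ,
    ENNReal.smul_def, smul_eq_mul, mul_one]
  exact_mod_cast h

theorem bernoulliMeasure_real_singleton_true {r : ℝ} (h0 : 0 ≤ r) :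
    (bernoulliMeasure r).real {true} = r := by
  simp [bernoulliMeasure, measureReal_def, h0]

theorem isProbabilityMeasure_bernoulliProduct (V : Type*) [Fintype V] {r : ℝ}
    (h0 : 0 ≤ r) (h1 : r ≤ 1) : IsProbabilityMeasure (bernoulliProduct V r) := by
  have := isProbabilityMeasure_bernoulliMeasure h0 h1
  unfold bernoulliProduct
  infer_instance

/-- A fixed set `s` is contained in a Bernoulli(r) random subset with probability `r ^ #s`. -/
theorem bernoulliProduct_real_subset {V : Type*} [Fintype V] {r : ℝ}
    (h0 : 0 ≤ r) (h1 : r ≤ 1) (s : Finset V) :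
    (bernoulliProduct V r).real {x | ∀ v ∈ s, x v = true} = r ^ s.card := by
  have := isProbabilityMeasure_bernoulliMeasure h0 h1
  have hs : {x : V → Bool | ∀ v ∈ s, x v = true} = (s : Set V).pi fun _ ↦ {true} := by
    ext x
    simp [Set.mem_pi]
  rw [hs, bernoulliProduct, measureReal_def, Measure.pi_pi_finset, ENNReal.toReal_prod]
  simp [← measureReal_def, bernoulliMeasure_real_singleton_true h0]

/-- Inclusion-exclusion lower bound for the probability that a Bernoulli(r) random subset contains
one of two distinct `k`-sets. -/
theorem two_mul_pow_sub_pow_succ_le_bernoulliProduct_real {V : Type*} [Fintype V] [DecidableEq V]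
    {r : ℝ} (h0 : 0 ≤ r) (h1 : r ≤ 1) {k : ℕ} {s u : Finset V} (hs : s.card = k)
    (hu : u.card = k) (hne : s ≠ u) :
    2 * r ^ k - r ^ (k + 1) ≤
      (bernoulliProduct V r).real ({x | ∀ v ∈ s, x v = true} ∪ {x | ∀ v ∈ u, x v = true}) := by
  have := isProbabilityMeasure_bernoulliProduct V h0 h1
  have hadd := measureReal_union_add_inter (μ := bernoulliProduct V r)
    (s := {x | ∀ v ∈ s, x v = true}) (t := {x | ∀ v ∈ u, x v = true}) (Set.toFinite _).measurableSet
  have hinter : {x : V → Bool | ∀ v ∈ s, x v = true} ∩ {x | ∀ v ∈ u, x v = true} =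
      {x | ∀ v ∈ s ∪ u, x v = true} := by
    ext x
    simp only [Set.mem_inter_iff, Set.mem_ofPred_eq, Finset.mem_union]
    grind
  have hcard : k + 1 ≤ (s ∪ u).card := by
    by_contra! hlt
    have h₁ : s = s ∪ u :=
      Finset.eq_of_subset_of_card_le Finset.subset_union_left (by omega)
    have h₂ : u = s ∪ u :=
      Finset.eq_of_subset_of_card_le Finset.subset_union_right (by omega)
    exact hne (h₁.trans h₂.symm)
  rw [hinter, bernoulliProduct_real_subset h0 h1, bernoulliProduct_real_subset h0 h1,
    bernoulliProduct_real_subset h0 h1, hs, hu] at hadd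
  have := pow_le_pow_of_le_one h0 h1 hcard
  linarith

/-- Hoeffding's lower-tail bound for the number of successes among independent repetitions of an
experiment. -/
theorem measure_pi_real_card_le {Ω : Type*} [MeasurableSpace Ω] (μ : Measure Ω)
    [IsProbabilityMeasure μ] {A : Set Ω} (hA : MeasurableSet A) (t : ℕ) {ε : ℝ} (hε : 0 ≤ ε) :
    (Measure.pi fun _ : Fin t ↦ μ).real
        {g | (Nat.card {i : Fin t // g i ∈ A} : ℝ) ≤ t * (μ.real A - ε)} ≤
      Real.exp (-2 * t * ε ^ 2) := by
  classical
  set f : Ω → ℝ := fun x ↦ μ.real A - A.indicator 1 x with hf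
  have hfm : Measurable f := measurable_const.sub (measurable_one.indicator hA)
  have hmem : ∀ x, f x ∈ Set.Icc (μ.real A - 1) (μ.real A) := by
    intro x
    by_cases hx : x ∈ A <;> simp [hf, hx]
  have hint : ∫ x, f x ∂μ = 0 := by
    have hi : Integrable (A.indicator (1 : Ω → ℝ)) μ := (integrable_const (1 : ℝ)).indicator hA
    simp only [hf]
    rw [integral_sub (integrable_const _) hi, integral_const, integral_indicator_one hA]
    simp
  have hindep : ProbabilityTheory.iIndepFun (fun (i : Fin t) g ↦ f (g i)) (Measure.pi fun _ : Fin t ↦ μ) :=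
    ProbabilityTheory.iIndepFun_pi fun _ ↦ hfm.aemeasurable
  have hsub : ∀ i ∈ (Finset.univ : Finset (Fin t)), ProbabilityTheory.HasSubgaussianMGF
      (fun g : Fin t → Ω ↦ f (g i)) ((‖μ.real A - (μ.real A - 1)‖₊ / 2) ^ 2)
      (Measure.pi fun _ : Fin t ↦ μ) := by
    intro i _
    refine ProbabilityTheory.hasSubgaussianMGF_of_mem_Icc_of_integral_eq_zero
      (hfm.comp (measurable_pi_apply i)).aemeasurable (.of_forall fun g ↦ hmem (g i)) ?_
    rw [← hint]
    exact integral_comp_eval (μ := fun _ : Fin t ↦ μ) hfm.aestronglyMeasurable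
  have key := ProbabilityTheory.HasSubgaussianMGF.measure_sum_ge_le_of_iIndepFun hindep hsub
    (ε := t * ε) (by positivity)
  have hset : {g : Fin t → Ω | (Nat.card {i : Fin t // g i ∈ A} : ℝ) ≤ t * (μ.real A - ε)} =
      {g | t * ε ≤ ∑ i, f (g i)} := by
    ext g
    have hcount : ∑ i, f (g i) = t * μ.real A - (Nat.card {i : Fin t // g i ∈ A} : ℝ) := by
      simp [hf, Finset.sum_sub_distrib, Set.indicator_apply, Nat.card_eq_fintype_card,
        Fintype.card_subtype]
    simp only [Set.mem_ofPred_eq, hcount, mul_sub]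
    constructor <;> intro h <;> linarith
  rw [hset]
  refine key.trans_eq ?_
  congr 1
  rcases eq_or_ne (t : ℝ) 0 with h | h
  · simp [h]
  · simp
    field_simp

theorem stmt7 {V : Type*} [Fintype V] [DecidableEq V] (k : ℕ) (hk : 1 ≤ k)
    (M : ℝ) (hM : M = (1 / Real.exp 1) * (1 - Real.exp (-(1 / (k : ℝ)))))
    (δ : ℝ) (hδ0 : 0 < δ) (hδ1 : δ < 1)
    (E : Finset (Finset V)) (hunif : ∀ e ∈ E, e.card = k)
    (B : Finset V) (h₁ h₂ : Finset V) (hh₁ : h₁ ∈ E) (hh₂ : h₂ ∈ E)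
    (hne : h₁ ≠ h₂) (hB₁ : h₁ ⊆ B) (hB₂ : h₂ ⊆ B)
    (t : ℕ) (ht : 2 * Real.log (2 / δ) / M ^ 2 ≤ (t : ℝ))
    -- `p̂ g` is the fraction of the `t` independent Bernoulli tests on `B`
    -- (the `i`-th test is the subset `{v ∈ B | g i v = true}`) that detect a hyperedge.
    (phat : (Fin t → V → Bool) → ℝ)
    (hphat : ∀ g, phat g =
      (Nat.card {i : Fin t // ∃ e ∈ E, e ⊆ B ∧ ∀ v ∈ e, g i v = true} : ℝ) / t) :
    1 - ENNReal.ofReal δ ≤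
      Measure.pi (fun _ : Fin t => bernoulliProduct V (Real.exp (-(1 / (k : ℝ)))))
        {g | 1 / Real.exp 1 + M / 2 ≤ phat g} := by
  obtain ⟨r, hr⟩ : ∃ r : ℝ, r = Real.exp (-(1 / (k : ℝ))) := ⟨_, rfl⟩
  rw [← hr] at hM ⊢
  have hk0 : (0 : ℝ) < k := by exact_mod_cast hk
  have hr0 : 0 ≤ r := hr ▸ (Real.exp_pos _).le
  have hr1 : r < 1 := by
    rw [hr, Real.exp_lt_one_iff]
    have : 0 < 1 / (k : ℝ) := by positivity
    linarith
  have hrk : r ^ k = 1 / Real.exp 1 := by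
    rw [hr, ← Real.exp_nat_mul, one_div (Real.exp 1), ← Real.exp_neg]
    congr 1
    field_simp
  have hM0 : 0 < M := by
    rw [hM]
    exact mul_pos (by positivity) (by linarith)
  have hlog : 0 < Real.log (2 / δ) := Real.log_pos (by rw [lt_div_iff₀ hδ0]; linarith)
  have ht0 : (0 : ℝ) < t := lt_of_lt_of_le (by positivity) ht
  have := isProbabilityMeasure_bernoulliProduct V hr0 hr1.le
  set μ := bernoulliProduct V r
  set A : Set (V → Bool) := {x | ∃ e ∈ E, e ⊆ B ∧ ∀ v ∈ e, x v = true} with hA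
  have hp : 1 / Real.exp 1 + M ≤ μ.real A := by
    refine le_trans (le_of_eq ?_) ((two_mul_pow_sub_pow_succ_le_bernoulliProduct_real hr0 hr1.le
      (hunif h₁ hh₁) (hunif h₂ hh₂) hne).trans (measureReal_mono ?_))
    · rw [pow_succ, hrk, hM]
      ring
    · rintro x (hx | hx)
      exacts [⟨h₁, hh₁, hB₁, hx⟩, ⟨h₂, hh₂, hB₂, hx⟩]
  have hexp : Real.exp (-2 * t * (M / 2) ^ 2) ≤ δ := by
    rw [← Real.le_log_iff_exp_le hδ0]
    rw [div_le_iff₀ (by positivity)] at ht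
    rw [Real.log_div two_ne_zero hδ0.ne'] at ht hlog
    have := Real.log_pos one_lt_two
    nlinarith
  set P := Measure.pi fun _ : Fin t ↦ μ
  have hbad : P {g | 1 / Real.exp 1 + M / 2 ≤ phat g}ᶜ ≤ ENNReal.ofReal δ := by
    rw [← ofReal_measureReal]
    refine ENNReal.ofReal_le_ofReal (le_trans (measureReal_mono ?_)
      ((measure_pi_real_card_le μ (Set.toFinite A).measurableSet t (half_pos hM0).le).trans hexp))
    intro g hg
    simp only [Set.mem_compl_iff, Set.mem_ofPred_eq, not_le, hphat] at hg
    rw [div_lt_iff₀ ht0] at hg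
    refine hg.le.trans ?_
    rw [mul_comm]
    exact mul_le_mul_of_nonneg_left (by linarith) ht0.le
  rw [prob_compl_eq_one_sub (Set.toFinite _).measurableSet] at hbad
  exact tsub_le_iff_tsub_le.mp hbad
end
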